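/- Let 𝒢 be an ultragraph, R a field, N an R-module, and π : L_R(𝒢) → Hom_R(N) a representation. Suppose that N_{r(e)} = ⊕_{v∈r(e)} N_v (internal direct sum) for each e ∈ 𝒢¹. If there exists n ≥ 1 such that X₁, …, X_n are all nonempty and (⋃_{e∈𝒢¹} r(e)) ∪ s(𝒢¹) = ⋃_{i=1}^n (X̄_i ∪ I_i), then π is permutative. -/

import Mathlib

universe u v w

/-- An ultragraph `𝒢 = (G⁰, 𝒢¹, r, s)`: a set of vertices `V`, a set of edges `E`,
a source map `s : E → V` and a range map `r : E → P(V) ∖ {∅}`. -/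
structure Ultragraph (V : Type u) (E : Type v) where
  s : E → V
  r : E → Set V
  r_nonempty : ∀ e, (r e).Nonempty

namespace Ultragraph

variable {V : Type u} {E : Type v}

/-- The collection `𝒢⁰` of generalized vertices: the smallest collection of subsets of `V`
containing all singletons and all ranges, closed under finite unions and intersections
(it contains the empty set). -/
inductive IsG0 (G : Ultragraph V E) : Set V → Prop
  | empty : IsG0 G ∅
  | singleton (v : V) : IsG0 G {v}
  | range (e : E) : IsG0 G (G.r e)
  | union {A B : Set V} : IsG0 G A → IsG0 G B → IsG0 G (A ∪ B)
  | inter {A B : Set V} : IsG0 G A → IsG0 G B → IsG0 G (A ∩ B)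

/-- `𝒢⁰` as a type. -/
def G0 (G : Ultragraph V E) : Type u := {A : Set V // G.IsG0 A}

def vtx (G : Ultragraph V E) (v : V) : G.G0 := ⟨{v}, IsG0.singleton v⟩

def rng (G : Ultragraph V E) (e : E) : G.G0 := ⟨G.r e, IsG0.range e⟩

def emptyG0 (G : Ultragraph V E) : G.G0 := ⟨∅, IsG0.empty⟩

def interG0 (G : Ultragraph V E) (A B : G.G0) : G.G0 := ⟨A.1 ∩ B.1, A.2.inter B.2⟩

def unionG0 (G : Ultragraph V E) (A B : G.G0) : G.G0 := ⟨A.1 ∪ B.1, A.2.union B.2⟩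

/-- Generators of the ultragraph Leavitt path algebra: edges `s_e`, ghost edges `s_e*`,
and projections `p_A` for `A ∈ 𝒢⁰`. -/
inductive LGen (G : Ultragraph V E) : Type max u v
  | edge (e : E) : LGen G
  | ghost (e : E) : LGen G
  | proj (A : G.G0) : LGen G

/-- The defining relations of the ultragraph Leavitt path algebra, as a relation on the
free `R`-algebra on the generators. -/
inductive LeavittRel (R : Type w) [CommRing R] (G : Ultragraph V E) :
    FreeAlgebra R (LGen G) → FreeAlgebra R (LGen G) → Prop
  | p_empty :
      LeavittRel R G (FreeAlgebra.ι R (LGen.proj G.emptyG0)) 0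
  | p_mul (A B : G.G0) :
      LeavittRel R G (FreeAlgebra.ι R (LGen.proj A) * FreeAlgebra.ι R (LGen.proj B))
        (FreeAlgebra.ι R (LGen.proj (G.interG0 A B)))
  | p_union (A B : G.G0) :
      LeavittRel R G (FreeAlgebra.ι R (LGen.proj (G.unionG0 A B)))
        (FreeAlgebra.ι R (LGen.proj A) + FreeAlgebra.ι R (LGen.proj B)
          - FreeAlgebra.ι R (LGen.proj (G.interG0 A B)))
  | src_edge (e : E) :
      LeavittRel R G
        (FreeAlgebra.ι R (LGen.proj (G.vtx (G.s e))) * FreeAlgebra.ι R (LGen.edge e))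
        (FreeAlgebra.ι R (LGen.edge e))
  | edge_rng (e : E) :
      LeavittRel R G
        (FreeAlgebra.ι R (LGen.edge e) * FreeAlgebra.ι R (LGen.proj (G.rng e)))
        (FreeAlgebra.ι R (LGen.edge e))
  | rng_ghost (e : E) :
      LeavittRel R G
        (FreeAlgebra.ι R (LGen.proj (G.rng e)) * FreeAlgebra.ι R (LGen.ghost e))
        (FreeAlgebra.ι R (LGen.ghost e))
  | ghost_src (e : E) :
      LeavittRel R G
        (FreeAlgebra.ι R (LGen.ghost e) * FreeAlgebra.ι R (LGen.proj (G.vtx (G.s e))))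
        (FreeAlgebra.ι R (LGen.ghost e))
  | ghost_edge_ne {e f : E} (h : e ≠ f) :
      LeavittRel R G (FreeAlgebra.ι R (LGen.ghost e) * FreeAlgebra.ι R (LGen.edge f)) 0
  | ghost_edge (e : E) :
      LeavittRel R G (FreeAlgebra.ι R (LGen.ghost e) * FreeAlgebra.ι R (LGen.edge e))
        (FreeAlgebra.ι R (LGen.proj (G.rng e)))
  | ck (v : V) (hfin : {e : E | G.s e = v}.Finite) (hne : {e : E | G.s e = v}.Nonempty) :
      LeavittRel R G (FreeAlgebra.ι R (LGen.proj (G.vtx v)))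
        (∑ e ∈ hfin.toFinset, FreeAlgebra.ι R (LGen.edge e) * FreeAlgebra.ι R (LGen.ghost e))

/-- The ultragraph Leavitt path algebra `L_R(𝒢)`. -/
def LeavittAlgebra (R : Type w) [CommRing R] (G : Ultragraph V E) : Type max u v w :=
  RingQuot (LeavittRel R G)

instance (R : Type w) [CommRing R] (G : Ultragraph V E) : Ring (LeavittAlgebra R G) :=
  inferInstanceAs (Ring (RingQuot (LeavittRel R G)))

instance (R : Type w) [CommRing R] (G : Ultragraph V E) : Algebra R (LeavittAlgebra R G) :=
  inferInstanceAs (Algebra R (RingQuot (LeavittRel R G)))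

/-- The projection `p_A ∈ L_R(𝒢)`, for `A ∈ 𝒢⁰`. -/
def Pg (G : Ultragraph V E) (R : Type w) [CommRing R] (A : G.G0) : LeavittAlgebra R G :=
  RingQuot.mkAlgHom R (LeavittRel R G) (FreeAlgebra.ι R (LGen.proj A))

/-- The element `s_e ∈ L_R(𝒢)`. -/
def Se (G : Ultragraph V E) (R : Type w) [CommRing R] (e : E) : LeavittAlgebra R G :=
  RingQuot.mkAlgHom R (LeavittRel R G) (FreeAlgebra.ι R (LGen.edge e))

/-- The element `s_e* ∈ L_R(𝒢)`. -/
def St (G : Ultragraph V E) (R : Type w) [CommRing R] (e : E) : LeavittAlgebra R G :=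
  RingQuot.mkAlgHom R (LeavittRel R G) (FreeAlgebra.ι R (LGen.ghost e))

/-- For a finite path `c = c₁ ⋯ c_k`, the element `s_c = s_{c₁} ⋯ s_{c_k}`
(the empty product for the empty list). -/
def Sp (G : Ultragraph V E) (R : Type w) [CommRing R] (c : List E) : LeavittAlgebra R G :=
  (c.map (G.Se R)).prod

/-- A (finite, nonempty) path in the ultragraph. -/
def IsPath (G : Ultragraph V E) (c : List E) : Prop :=
  c ≠ [] ∧ c.Chain' (fun e f => G.s f ∈ G.r e)

/-- A closed path: a path with `s(c₁) ∈ r(c_k)`. -/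
def IsClosedPath (G : Ultragraph V E) (c : List E) : Prop :=
  ∃ h : G.IsPath c, G.s (c.head h.1) ∈ G.r (c.getLast h.1)

/-- A cycle: a closed path whose edges have pairwise distinct sources. -/
def IsCycle (G : Ultragraph V E) (c : List E) : Prop :=
  G.IsClosedPath c ∧ c.Pairwise (fun e f => G.s e ≠ G.s f)

/-- A sink: a vertex emitting no edges. -/
def IsSink (G : Ultragraph V E) (v : V) : Prop := ∀ e, G.s e ≠ v

/-- An exit for a closed path `c`: an edge `f` with `s(f) ∈ r(c_i)` and `f ≠ c_{i+1}`
(indices cyclic), or a sink in some `r(c_i)`. -/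
def HasExit (G : Ultragraph V E) (c : List E) : Prop :=
  (∃ (f : E) (i : Fin c.length), G.s f ∈ G.r (c.get i) ∧
      f ≠ c.get ⟨(i.1 + 1) % c.length, Nat.mod_lt _ i.pos⟩) ∨
  (∃ (w : V) (i : Fin c.length), G.IsSink w ∧ w ∈ G.r (c.get i))

/-- Condition (L): every closed path has an exit. -/
def ConditionL (G : Ultragraph V E) : Prop :=
  ∀ c : List E, G.IsClosedPath c → G.HasExit c

/-- The range `r(c)` of a finite path `c` (the range of its last edge). -/
def pathRange (G : Ultragraph V E) (c : List E) : Set V :=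
  (c.getLast?.map G.r).getD ∅

theorem isG0_pathRange (G : Ultragraph V E) (c : List E) : G.IsG0 (G.pathRange c) := by
  unfold pathRange
  cases c.getLast? with
  | none => exact IsG0.empty
  | some e => exact IsG0.range e

/-- The range of a path, as an element of `𝒢⁰`. -/
def pathRng (G : Ultragraph V E) (c : List E) : G.G0 :=
  ⟨G.pathRange c, G.isG0_pathRange c⟩

end Ultragraph
namespace Ultragraph

open scoped Classical

variable {V : Type u} {E : Type v}

/-- A `𝒢`-algebraic branching system on a set `X`. -/
structure BranchingSystem (G : Ultragraph V E) (X : Type*) where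
  Re : E → Set X
  D : G.G0 → Set X
  disj : ∀ ⦃e f : E⦄, e ≠ f → Re e ∩ Re f = ∅
  D_empty : D G.emptyG0 = ∅
  D_inter : ∀ A B : G.G0, D A ∩ D B = D (G.interG0 A B)
  D_union : ∀ A B : G.G0, D A ∪ D B = D (G.unionG0 A B)
  Re_subset : ∀ e : E, Re e ⊆ D (G.vtx (G.s e))
  D_vtx : ∀ v : V, {e : E | G.s e = v}.Finite → {e : E | G.s e = v}.Nonempty →
    D (G.vtx v) = ⋃ e ∈ {e : E | G.s e = v}, Re e
  fe : ∀ e : E, ↥(D (G.rng e)) ≃ ↥(Re e)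

namespace BranchingSystem

variable {G : Ultragraph V E} {X : Type*}

/-- The extension of `f_e : D_{r(e)} → R_e` to a function `X → X` (identity elsewhere). -/
noncomputable def tot (B : BranchingSystem G X) (e : E) : X → X := fun x =>
  if h : x ∈ B.D (G.rng e) then (B.fe e ⟨x, h⟩ : X) else x

/-- For a path `c = c₁ ⋯ c_k`, the composite `f_c = f_{c₁} ∘ ⋯ ∘ f_{c_k}` (extended). -/
noncomputable def pathMap (B : BranchingSystem G X) (c : List E) : X → X :=
  c.foldr (fun e g => B.tot e ∘ g) id

end BranchingSystem

/-- `π : L_R(𝒢) → Hom_R(M)`, with `M` the module of all functions `X → R`, is the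
representation induced by the branching system `B` if it satisfies the defining formulas
`π(s_e)(φ) = (φ ∘ f_e⁻¹)·1_{R_e}`, `π(s_e*)(φ) = (φ ∘ f_e)·1_{D_{r(e)}}`,
`π(p_A)(φ) = 1_{D_A}·φ`. -/
def IsInducedRep (G : Ultragraph V E) (R : Type w) [CommRing R] {X : Type*}
    (B : BranchingSystem G X)
    (π : LeavittAlgebra R G →ₐ[R] Module.End R (X → R)) : Prop :=
  (∀ (e : E) (φ : X → R) (x : X),
      π (G.Se R e) φ x = if h : x ∈ B.Re e then φ ((B.fe e).symm ⟨x, h⟩ : X) else 0) ∧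
  (∀ (e : E) (φ : X → R) (x : X),
      π (G.St R e) φ x = if h : x ∈ B.D (G.rng e) then φ ((B.fe e ⟨x, h⟩ : X)) else 0) ∧
  (∀ (A : G.G0) (φ : X → R) (x : X),
      π (G.Pg R A) φ x = if x ∈ B.D A then φ x else 0)

/-- The analogue of `IsInducedRep` for the module of finitely supported functions `X →₀ R`. -/
def IsInducedRepF (G : Ultragraph V E) (R : Type w) [CommRing R] {X : Type*}
    (B : BranchingSystem G X)
    (π : LeavittAlgebra R G →ₐ[R] Module.End R (X →₀ R)) : Prop :=
  (∀ (e : E) (φ : X →₀ R) (x : X),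
      π (G.Se R e) φ x = if h : x ∈ B.Re e then φ ((B.fe e).symm ⟨x, h⟩ : X) else 0) ∧
  (∀ (e : E) (φ : X →₀ R) (x : X),
      π (G.St R e) φ x = if h : x ∈ B.D (G.rng e) then φ ((B.fe e ⟨x, h⟩ : X)) else 0) ∧
  (∀ (A : G.G0) (φ : X →₀ R) (x : X),
      π (G.Pg R A) φ x = if x ∈ B.D A then φ x else 0)

section Representations

variable (G : Ultragraph V E) (R : Type w) [CommRing R]
variable {N : Type*} [AddCommGroup N] [Module R N]

/-- `S` is a basis of the submodule `W`: it is contained in `W`, linearly independent,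
and spans `W`. -/
def IsBasisOf (S : Set N) (W : Submodule R N) : Prop :=
  S ⊆ (W : Set N) ∧ LinearIndependent R ((↑) : S → N) ∧ Submodule.span R S = W

/-- The submodule `N_v = π(p_v)(N)`. -/
def NvSub (π : LeavittAlgebra R G →ₐ[R] Module.End R N) (v : V) : Submodule R N :=
  LinearMap.range (π (G.Pg R (G.vtx v)))

/-- The submodule `N_{r(e)} = π(p_{r(e)})(N)`. -/
def NreSub (π : LeavittAlgebra R G →ₐ[R] Module.End R N) (e : E) : Submodule R N :=
  LinearMap.range (π (G.Pg R (G.rng e)))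

/-- The submodule `N_A = π(p_A)(N)`. -/
def NASub (π : LeavittAlgebra R G →ₐ[R] Module.End R N) (A : G.G0) : Submodule R N :=
  LinearMap.range (π (G.Pg R A))

/-- The submodule `N_e = π(s_e s_e*)(N)`. -/
def NeSub (π : LeavittAlgebra R G →ₐ[R] Module.End R N) (e : E) : Submodule R N :=
  LinearMap.range (π (G.Se R e * G.St R e))

/-- The data exhibiting a representation `π : L_R(𝒢) → Hom_R(N)` as permutative:
bases `B` of `N`, `B_v` of `N_v`, `B_{r(e)}` of `N_{r(e)}`, `B_e` of `N_e` with
`B_v, B_{r(e)} ⊆ B`, `B_v ⊆ B_{r(e)}` for `v ∈ r(e)`, `B_e ⊆ B_{s(e)}`, and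
`π(s_e)(B_{r(e)}) = B_e`. -/
structure PermutativeData (π : LeavittAlgebra R G →ₐ[R] Module.End R N) where
  B : Set N
  Bv : V → Set N
  Br : E → Set N
  Be : E → Set N
  hB : LinearIndependent R ((↑) : B → N) ∧ Submodule.span R B = ⊤
  hBv : ∀ v : V, IsBasisOf R (Bv v) (NvSub G R π v)
  hBr : ∀ e : E, IsBasisOf R (Br e) (NreSub G R π e)
  hBe : ∀ e : E, IsBasisOf R (Be e) (NeSub G R π e)
  hBvB : ∀ v : V, Bv v ⊆ B
  hBrB : ∀ e : E, Br e ⊆ B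
  hBvBr : ∀ (e : E) (v : V), v ∈ G.r e → Bv v ⊆ Br e
  hBeBv : ∀ e : E, Be e ⊆ Bv (G.s e)
  hmap : ∀ e : E, (π (G.Se R e)) '' (Br e) = Be e

/-- A representation is permutative if such data exists. -/
def IsPermutative (π : LeavittAlgebra R G →ₐ[R] Module.End R N) : Prop :=
  Nonempty (PermutativeData G R π)

end Representations

/-- A description of `A ∈ 𝒢⁰` as `(⋂_{e∈X₁} r(e)) ∪ ⋯ ∪ (⋂_{e∈Xₙ} r(e)) ∪ F`
with each `Xᵢ` a nonempty finite set of edges and `F` a finite set of vertices. -/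
structure G0Desc (G : Ultragraph V E) (A : Set V) where
  n : ℕ
  Xs : Fin n → Finset E
  hXs : ∀ i, (Xs i).Nonempty
  F : Finset V
  eq : A = (⋃ i, ⋂ e ∈ (Xs i : Set E), G.r e) ∪ (F : Set V)

/-- The set `B_A` associated to a description of `A ∈ 𝒢⁰` and permutative data. -/
def BAset {G : Ultragraph V E} (R : Type w) [CommRing R]
    {N : Type*} [AddCommGroup N] [Module R N]
    {π : LeavittAlgebra R G →ₐ[R] Module.End R N}
    (P : PermutativeData G R π) {A : Set V} (d : G0Desc G A) : Set N :=
  (⋃ i, ⋂ e ∈ (d.Xs i : Set E), P.Br e) ∪ ⋃ v ∈ (d.F : Set V), P.Bv v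

end Ultragraph
namespace Ultragraph

variable {V : Type u} {E : Type v}

/-! ### Extreme vertices and the iterated construction `𝔾ₙ`, `Xₙ`, `Yₙ`, `Iₙ`

A sub-ultragraph is recorded as a pair `(W, Ed)` of a set of remaining vertices and a set
of remaining edges; ranges are intersected with `W`. -/

/-- `e` is the extreme edge of the extreme vertex `A = r(e) ∩ W` of the sub-ultragraph
`(W, Ed)`: `r(e)` meets no other range and no source. -/
def IsExtremeRangeEdge (G : Ultragraph V E) (W : Set V) (Ed : Set E) (e : E) : Prop :=
  e ∈ Ed ∧ (∀ f ∈ Ed, f ≠ e → (G.r e ∩ W) ∩ (G.r f ∩ W) = ∅) ∧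
    (∀ f ∈ Ed, G.s f ∉ G.r e ∩ W)

/-- `e` is the extreme edge of the extreme vertex `A = {s(e)}` of the sub-ultragraph
`(W, Ed)`: `s(e)` is the source of no other edge and lies in no range. -/
def IsExtremeSourceEdge (G : Ultragraph V E) (W : Set V) (Ed : Set E) (e : E) : Prop :=
  e ∈ Ed ∧ G.s e ∈ W ∧ (∀ f ∈ Ed, f ≠ e → G.s f ≠ G.s e) ∧
    (∀ f ∈ Ed, G.s e ∉ G.r f ∩ W)

/-- The set of extreme vertices of the sub-ultragraph `(W, Ed)`. -/
def ExtremeVertSets (G : Ultragraph V E) (W : Set V) (Ed : Set E) : Set (Set V) :=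
  {A | (∃ e, G.IsExtremeRangeEdge W Ed e ∧ A = G.r e ∩ W) ∨
    (∃ e, G.IsExtremeSourceEdge W Ed e ∧ A = {G.s e})}

/-- The set of extreme edges of the sub-ultragraph `(W, Ed)`. -/
def ExtremeEdges (G : Ultragraph V E) (W : Set V) (Ed : Set E) : Set E :=
  {e | G.IsExtremeRangeEdge W Ed e ∨ G.IsExtremeSourceEdge W Ed e}

/-- The isolated vertices of the sub-ultragraph `(W, Ed)`: vertices of `W` lying in no
range and being no source. -/
def Isolated (G : Ultragraph V E) (W : Set V) (Ed : Set E) : Set V :=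
  {v ∈ W | (∀ e ∈ Ed, v ∉ G.r e) ∧ (∀ e ∈ Ed, G.s e ≠ v)}

/-- `stage G n` is the sub-ultragraph `𝔾ₙ`; `stage G 0 = 𝔾₀` is obtained from `𝒢` by
removing the isolated vertices, and `𝔾ₙ₊₁` is obtained from `𝔾ₙ` by removing the extreme
vertices `X̄ₙ₊₁`, the extreme edges `Yₙ₊₁`, and then the resulting isolated vertices
`Iₙ₊₁`. -/
def stage (G : Ultragraph V E) : ℕ → Set V × Set E
  | 0 => ({w | w ∈ (⋃ e : E, G.r e) ∪ Set.range G.s}, Set.univ)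
  | n + 1 =>
      let p := stage G n
      let W' := p.1 \ ⋃₀ G.ExtremeVertSets p.1 p.2
      let Ed' := p.2 \ G.ExtremeEdges p.1 p.2
      (W' \ G.Isolated W' Ed', Ed')

/-- `XStep G n` is the set `Xₙ₊₁` of extreme vertices of `𝔾ₙ`. -/
def XStep (G : Ultragraph V E) (n : ℕ) : Set (Set V) :=
  G.ExtremeVertSets (G.stage n).1 (G.stage n).2

/-- `XbarStep G n` is `X̄ₙ₊₁ = ⋃_{A ∈ Xₙ₊₁} A`. -/
def XbarStep (G : Ultragraph V E) (n : ℕ) : Set V := ⋃₀ G.XStep n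

/-- `IStep G n` is the set `Iₙ₊₁` of isolated vertices of the ultragraph obtained from
`𝔾ₙ` by removing `X̄ₙ₊₁` and `Yₙ₊₁`. -/
def IStep (G : Ultragraph V E) (n : ℕ) : Set V :=
  G.Isolated ((G.stage n).1 \ G.XbarStep n)
    ((G.stage n).2 \ G.ExtremeEdges (G.stage n).1 (G.stage n).2)

end Ultragraph

namespace Ultragraph

section Helpers

variable {V : Type u} {E : Type v}

theorem stage_source_mem (G : Ultragraph V E) (n : ℕ) :
    ∀ f ∈ (G.stage n).2, G.s f ∈ (G.stage n).1 := by
  induction n with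
  | zero => intro f _; exact Or.inr ⟨f, rfl⟩
  | succ n ih =>
    rintro f ⟨hf, hfe⟩
    refine ⟨⟨ih f hf, ?_⟩, ?_⟩
    · rintro ⟨A, ⟨e, he, rfl⟩ | ⟨e, he, rfl⟩, hA⟩
      · exact he.2.2 f hf hA
      · by_cases h : f = e
        · subst h; exact hfe (Or.inr he)
        · exact he.2.2.1 f hf h hA
    · intro h
      exact h.2.2 f ⟨hf, hfe⟩ rfl

theorem stage_path_mem (G : Ultragraph V E) (e : ℕ → E)
    (he : ∀ k, G.s (e (k + 1)) ∈ G.r (e k)) (i : ℕ) :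
    ∀ k, i ≤ k → e k ∈ (G.stage i).2 := by
  induction i with
  | zero => intro k _; exact Set.mem_univ _
  | succ i ih =>
    intro k hk
    obtain ⟨j, rfl⟩ : ∃ j, k = j + 1 := ⟨k - 1, by omega⟩
    refine ⟨ih _ (by omega), ?_⟩
    rintro (h | h)
    · have h2 := ih (j + 1 + 1) (by omega)
      exact h.2.2 _ h2 ⟨he _, stage_source_mem G i _ h2⟩
    · exact h.2.2.2 (e j) (ih j (by omega)) ⟨he j, h.2.1⟩

theorem wf_of_exhaust (G : Ultragraph V E) (n : ℕ)
    (hn : (⋃ e : E, G.r e) ∪ Set.range G.s =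
      ⋃ i ∈ Finset.range n, (G.XbarStep i ∪ G.IStep i)) :
    WellFounded (fun w v : V => ∃ e, G.s e = v ∧ w ∈ G.r e) := by
  rw [wellFounded_iff_isEmpty_descending_chain]
  refine ⟨?_⟩
  rintro ⟨f, hf⟩
  choose e he1 he2 using hf
  have hp : ∀ k, G.s (e (k + 1)) ∈ G.r (e k) := fun k => by
    rw [he1]; exact he2 k
  have hm : G.s (e n) ∈ ⋃ i ∈ Finset.range n, (G.XbarStep i ∪ G.IStep i) := by
    rw [← hn]; exact Or.inr ⟨_, rfl⟩
  simp only [Set.mem_iUnion, Finset.mem_range] at hm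
  obtain ⟨i, hi, hx⟩ := hm
  have h1 := stage_source_mem G (i + 1) _ (stage_path_mem G e hp (i + 1) n hi)
  rcases hx with hx | hx
  · exact h1.1.2 hx
  · exact h1.2 hx

variable (G : Ultragraph V E) (R : Type w) [CommRing R]

theorem Pg_empty : G.Pg R G.emptyG0 = 0 :=
  (RingQuot.mkAlgHom_rel R (LeavittRel.p_empty)).trans (map_zero _)

theorem Pg_mul (A B : G.G0) : G.Pg R A * G.Pg R B = G.Pg R (G.interG0 A B) :=
  (map_mul _ _ _).symm.trans (RingQuot.mkAlgHom_rel R (LeavittRel.p_mul A B))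

theorem src_Se (e : E) : G.Pg R (G.vtx (G.s e)) * G.Se R e = G.Se R e :=
  (map_mul _ _ _).symm.trans (RingQuot.mkAlgHom_rel R (LeavittRel.src_edge e))

theorem Se_rng (e : E) : G.Se R e * G.Pg R (G.rng e) = G.Se R e :=
  (map_mul _ _ _).symm.trans (RingQuot.mkAlgHom_rel R (LeavittRel.edge_rng e))

theorem rng_St (e : E) : G.Pg R (G.rng e) * G.St R e = G.St R e :=
  (map_mul _ _ _).symm.trans (RingQuot.mkAlgHom_rel R (LeavittRel.rng_ghost e))

theorem St_Se (e : E) : G.St R e * G.Se R e = G.Pg R (G.rng e) :=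
  (map_mul _ _ _).symm.trans (RingQuot.mkAlgHom_rel R (LeavittRel.ghost_edge e))

theorem St_Se_ne {e f : E} (h : e ≠ f) : G.St R e * G.Se R f = 0 :=
  ((map_mul _ _ _).symm.trans (RingQuot.mkAlgHom_rel R (LeavittRel.ghost_edge_ne h))).trans
    (map_zero _)

theorem Pg_idem (A : G.G0) : G.Pg R A * G.Pg R A = G.Pg R A := by
  rw [Pg_mul]; congr 1; exact Subtype.ext (Set.inter_self _)

theorem Pg_vtx_ne {v w : V} (h : v ≠ w) : G.Pg R (G.vtx v) * G.Pg R (G.vtx w) = 0 := by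
  rw [Pg_mul, ← Pg_empty]; congr 1
  exact Subtype.ext (Set.singleton_inter_eq_empty.2 (fun hh => h hh))

end Helpers

section Lin

variable {R : Type w} [Field R] {N : Type*} [AddCommGroup N] [Module R N]

theorem linIndep_union {ι : Type*} (S : ι → Set N) (P : ι → Module.End R N)
    (hS : ∀ i, LinearIndepOn R id (S i)) (h1 : ∀ i, ∀ x ∈ S i, P i x = x)
    (h0 : ∀ i j, i ≠ j → ∀ x ∈ S j, P i x = 0) :
    LinearIndepOn R id (⋃ i, S i) := by
  apply linearIndepOn_id_iUnion_finite hS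
  intro i t _ hi
  rw [Submodule.disjoint_def]
  intro x hx hx'
  have e1 : P i x = x := by
    have : Submodule.span R (S i) ≤ LinearMap.eqLocus (P i) LinearMap.id :=
      Submodule.span_le.2 fun y hy => h1 i y hy
    exact this hx
  have e0 : P i x = 0 := by
    have : (⨆ j ∈ t, Submodule.span R (S j)) ≤ LinearMap.ker (P i) := by
      refine iSup₂_le fun j hj => Submodule.span_le.2 fun y hy => h0 i j ?_ y hy
      rintro rfl; exact hi hj
    exact this hx'
  rw [← e1, e0]

open scoped Classical in
/-- A basis of `W` extending `S`, when `S` is independent and contained in `W`. -/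
noncomputable def extBasis (R : Type w) [Field R] {N : Type*} [AddCommGroup N] [Module R N]
    (S : Set N) (W : Submodule R N) : Set N :=
  if h : LinearIndepOn R id S ∧ S ⊆ (W : Set N) then h.1.extend h.2 else ∅

theorem extBasis_spec {S : Set N} {W : Submodule R N} (h : LinearIndepOn R id S)
    (h' : S ⊆ (W : Set N)) :
    S ⊆ extBasis R S W ∧ IsBasisOf R (extBasis R S W) W := by
  have hd : extBasis R S W = h.extend h' := dif_pos ⟨h, h'⟩
  rw [hd]
  refine ⟨h.subset_extend h', h.extend_subset h', h.linearIndepOn_extend h', ?_⟩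
  rw [h.span_extend_eq_span h', Submodule.span_eq]

end Lin

section Main

variable {V : Type u} {E : Type v} (G : Ultragraph V E) (R : Type w) [Field R]
  {N : Type*} [AddCommGroup N] [Module R N]
  (π : LeavittAlgebra R G →ₐ[R] Module.End R N)

theorem Nv_fix {v : V} {x : N} (hx : x ∈ NvSub G R π v) : π (G.Pg R (G.vtx v)) x = x := by
  obtain ⟨y, rfl⟩ := hx
  rw [← Module.End.mul_apply, ← map_mul, Pg_idem]

theorem Nv_kill {v w : V} (h : v ≠ w) {x : N} (hx : x ∈ NvSub G R π w) :
    π (G.Pg R (G.vtx v)) x = 0 := by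
  obtain ⟨y, rfl⟩ := hx
  rw [← Module.End.mul_apply, ← map_mul, Pg_vtx_ne G R h, map_zero, LinearMap.zero_apply]

theorem Nre_fix {e : E} {x : N} (hx : x ∈ NreSub G R π e) : π (G.Pg R (G.rng e)) x = x := by
  obtain ⟨y, rfl⟩ := hx
  rw [← Module.End.mul_apply, ← map_mul, Pg_idem]

theorem St_Se_apply {e : E} {x : N} (hx : x ∈ NreSub G R π e) :
    π (G.St R e) (π (G.Se R e) x) = x := by
  rw [← Module.End.mul_apply, ← map_mul, St_Se, Nre_fix G R π hx]

theorem Se_mem_Nv (e : E) (x : N) : π (G.Se R e) x ∈ NvSub G R π (G.s e) := by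
  refine ⟨π (G.Se R e) x, ?_⟩
  rw [← Module.End.mul_apply, ← map_mul, src_Se]

theorem map_Nre (e : E) : (NreSub G R π e).map (π (G.Se R e)) = NeSub G R π e := by
  apply le_antisymm
  · rintro _ ⟨x, hx, rfl⟩
    refine ⟨π (G.Se R e) x, ?_⟩
    rw [map_mul, Module.End.mul_apply, St_Se_apply G R π hx]
  · rintro _ ⟨x, rfl⟩
    refine ⟨π (G.St R e) x, ⟨π (G.St R e) x, ?_⟩, ?_⟩
    · rw [← Module.End.mul_apply, ← map_mul, rng_St]
    · rw [map_mul, Module.End.mul_apply]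

theorem basis_Nre (hsup : ∀ e : E, (⨆ v : ↥(G.r e), NvSub G R π (v : V)) = NreSub G R π e)
    (Bv : V → Set N) (e : E) (h : ∀ v ∈ G.r e, IsBasisOf R (Bv v) (NvSub G R π v)) :
    IsBasisOf R (⋃ v : ↥(G.r e), Bv v) (NreSub G R π e) := by
  have hs : Submodule.span R (⋃ v : ↥(G.r e), Bv v) = NreSub G R π e := by
    rw [Submodule.span_iUnion, ← hsup e]
    exact iSup_congr fun v => (h v v.2).2.2
  refine ⟨?_, ?_, hs⟩
  · rw [← hs]; exact Submodule.subset_span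
  · apply linIndep_union (R := R) (fun v : ↥(G.r e) => Bv v)
      (fun v => π (G.Pg R (G.vtx v)))
    · exact fun v => (h v v.2).2.1
    · exact fun v x hx => Nv_fix G R π ((h v v.2).1 hx)
    · intro v w hvw x hx
      exact Nv_kill G R π (fun hh => hvw (Subtype.ext hh)) ((h w w.2).1 hx)

theorem basis_Ne {S : Set N} {e : E} (h : IsBasisOf R S (NreSub G R π e)) :
    IsBasisOf R (π (G.Se R e) '' S) (NeSub G R π e) := by
  have hs : Submodule.span R (π (G.Se R e) '' S) = NeSub G R π e := by
    rw [← map_Nre, ← h.2.2, Submodule.map_span]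
  refine ⟨?_, ?_, hs⟩
  · rw [← hs]; exact Submodule.subset_span
  · have hl : LinearIndepOn R id S := h.2.1
    refine LinearIndepOn.id_image (LinearIndepOn.map_injOn hl (π (G.Se R e)) ?_)
    simp only [Set.image_id]
    rw [h.2.2]
    intro x hx y hy hxy
    have := congrArg (π (G.St R e)) hxy
    rwa [St_Se_apply G R π hx, St_Se_apply G R π hy] at this

theorem exists_vertex_bases
    (hsup : ∀ e : E, (⨆ v : ↥(G.r e), NvSub G R π (v : V)) = NreSub G R π e)
    (wf : WellFounded (fun w v : V => ∃ e, G.s e = v ∧ w ∈ G.r e)) :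
    ∃ Bv : V → Set N, (∀ v, IsBasisOf R (Bv v) (NvSub G R π v)) ∧
      ∀ e, π (G.Se R e) '' (⋃ w : ↥(G.r e), Bv w) ⊆ Bv (G.s e) := by
  let F : ∀ v : V, (∀ w, (∃ e, G.s e = v ∧ w ∈ G.r e) → Set N) → Set N := fun v ih =>
    extBasis R (⋃ e : {e : E // G.s e = v},
      π (G.Se R e.1) '' (⋃ w : ↥(G.r e.1), ih w ⟨e.1, e.2, w.2⟩)) (NvSub G R π v)
  let Bv : V → Set N := wf.fix F
  have hfix : ∀ v, Bv v = extBasis R (⋃ e : {e : E // G.s e = v},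
      π (G.Se R e.1) '' (⋃ w : ↥(G.r e.1), Bv w)) (NvSub G R π v) :=
    fun v => wf.fix_eq F v
  have key : ∀ v, (∀ w, (∃ e, G.s e = v ∧ w ∈ G.r e) → IsBasisOf R (Bv w) (NvSub G R π w)) →
      (⋃ e : {e : E // G.s e = v}, π (G.Se R e.1) '' (⋃ w : ↥(G.r e.1), Bv w)) ⊆ Bv v ∧
        IsBasisOf R (Bv v) (NvSub G R π v) := by
    intro v ih
    have hre : ∀ e : {e : E // G.s e = v},
        IsBasisOf R (⋃ w : ↥(G.r e.1), Bv w) (NreSub G R π e.1) := fun e =>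
      basis_Nre G R π hsup Bv e.1 fun w hw => ih w ⟨e.1, e.2, hw⟩
    rw [hfix v]
    apply extBasis_spec
    · apply linIndep_union (R := R) _ (fun e : {e : E // G.s e = v} =>
        π (G.Se R e.1) * π (G.St R e.1))
      · exact fun e => (basis_Ne G R π (hre e)).2.1
      · rintro e _ ⟨x, hx, rfl⟩
        rw [Module.End.mul_apply, St_Se_apply G R π ((hre e).1 hx)]
      · rintro e f hef _ ⟨x, hx, rfl⟩
        have h0 : π (G.St R e.1) (π (G.Se R f.1) x) = 0 := by
          rw [← Module.End.mul_apply, ← map_mul,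
            St_Se_ne G R (fun hh => hef (Subtype.ext hh)), map_zero, LinearMap.zero_apply]
        rw [Module.End.mul_apply, h0, map_zero]
    · refine Set.iUnion_subset ?_
      rintro ⟨e, rfl⟩ _ ⟨x, hx, rfl⟩
      exact Se_mem_Nv G R π e x
  have hb : ∀ v, IsBasisOf R (Bv v) (NvSub G R π v) := fun v =>
    wf.induction (C := fun v => IsBasisOf R (Bv v) (NvSub G R π v)) v fun v ih => (key v ih).2
  refine ⟨Bv, hb, fun e => ?_⟩
  exact (Set.subset_iUnion (fun f : {f : E // G.s f = G.s e} =>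
    π (G.Se R f.1) '' (⋃ w : ↥(G.r f.1), Bv w)) ⟨e, rfl⟩).trans (key _ fun w _ => hb w).1

end Main

end Ultragraph

universe x

open Ultragraph in
/-- If `N_{r(e)} = ⊕_{v ∈ r(e)} N_v` for each edge `e`, and the iterated extreme-vertex
construction exhausts `(⋃_e r(e)) ∪ s(𝒢¹)` after `n ≥ 1` steps with `X₁, …, Xₙ ≠ ∅`,
then every representation `π : L_R(𝒢) → Hom_R(N)` over a field `R` is permutative. -/
theorem representation_permutative {V : Type u} {E : Type v}
    (G : Ultragraph V E) (R : Type w) [Field R]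
    {N : Type x} [AddCommGroup N] [Module R N]
    (π : LeavittAlgebra R G →ₐ[R] Module.End R N)
    (hdir : ∀ e : E,
      iSupIndep (fun v : ↥(G.r e) => NvSub G R π (v : V)) ∧
      (⨆ v : ↥(G.r e), NvSub G R π (v : V)) = NreSub G R π e)
    (hn : ∃ n : ℕ, 1 ≤ n ∧ (∀ i < n, (G.XStep i).Nonempty) ∧
      (⋃ e : E, G.r e) ∪ Set.range G.s = ⋃ i ∈ Finset.range n, (G.XbarStep i ∪ G.IStep i)) :
    IsPermutative G R π := by
  obtain ⟨n, -, -, hn⟩ := hn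
  have hsup := fun e => (hdir e).2
  obtain ⟨Bv, hb, hsub⟩ := exists_vertex_bases G R π hsup (wf_of_exhaust G n hn)
  have hli : LinearIndepOn R id (⋃ v, Bv v) := by
    apply linIndep_union (R := R) Bv (fun v => π (G.Pg R (G.vtx v)))
    · exact fun v => (hb v).2.1
    · exact fun v x hx => Nv_fix G R π ((hb v).1 hx)
    · exact fun v w hvw x hx => Nv_kill G R π hvw ((hb w).1 hx)
  obtain ⟨hB1, hB2⟩ := extBasis_spec (W := ⊤) hli (fun _ _ => trivial)
  have hre := fun e => basis_Nre G R π hsup Bv e fun v _ => hb v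
  exact ⟨{
    B := extBasis R (⋃ v, Bv v) ⊤
    Bv := Bv
    Br := fun e => ⋃ v : ↥(G.r e), Bv v
    Be := fun e => π (G.Se R e) '' (⋃ v : ↥(G.r e), Bv v)
    hB := hB2.2
    hBv := hb
    hBr := hre
    hBe := fun e => basis_Ne G R π (hre e)
    hBvB := fun v => (Set.subset_iUnion Bv v).trans hB1
    hBrB := fun e => (Set.iUnion_subset fun v : ↥(G.r e) => Set.subset_iUnion Bv (v : V)).trans hB1
    hBvBr := fun e v hv => Set.subset_iUnion (fun v : ↥(G.r e) => Bv v) ⟨v, hv⟩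
    hBeBv := hsub
    hmap := fun _ => rfl }⟩
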